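/- There is a constant c such that for all m > n ≥ 1 there is a cost-SR derivation from BPHP(m,n) of length at most (m+n)^c containing unit clauses for m−n distinct blocking variables and the unit clauses ¬b for every other blocking variable b; i.e., cost-SR proves cost(BPHP(m,n)) = m−n in polynomial size. -/

import Mathlib

namespace PaperMaxSAT

/-- Variables are natural numbers. -/
abbrev Var := ℕ

/-- A literal is a variable together with a polarity. -/
abbrev Lit := Var × Bool

/-- Negation of a literal. -/
def negLit (l : Lit) : Lit := (l.1, !l.2)

/-- A clause is a finite set of literals. -/
abbrev Clause := Finset Lit

/-- A CNF formula is a finite multiset of clauses. -/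
abbrev CNF := Multiset Clause

/-- A tautological clause contains a literal together with its negation. -/
def isTaut (C : Clause) : Prop := ∃ l ∈ C, negLit l ∈ C

/-- The value of a substitution at a variable: a Boolean constant or a literal. -/
abbrev SubVal := Bool ⊕ Lit

/-- Negation on substitution values. -/
def negSV : SubVal → SubVal
  | .inl b => .inl !b
  | .inr l => .inr (negLit l)

/-- A substitution maps each variable to `0`, `1` or a literal. -/
abbrev Sub := Var → SubVal

/-- Applying a substitution to a literal, respecting `σ(¬x) = ¬σ(x)`. -/
def appLit (σ : Sub) (l : Lit) : SubVal :=
  if l.2 then σ l.1 else negSV (σ l.1)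

/-- The identity substitution. -/
def idSub : Sub := fun v => .inr (v, true)

/-- `σ(C) = 1` : some literal of `C` is mapped to true by `σ`. -/
def clauseTrue (σ : Sub) (C : Clause) : Prop := ∃ l ∈ C, appLit σ l = Sum.inl true

instance (σ : Sub) (C : Clause) : Decidable (clauseTrue σ C) := by
  unfold clauseTrue; infer_instance

/-- `C↾σ` : the clause whose literals are the images under `σ` of the literals
of `C` mapped to literals (literals mapped to `0` are dropped). -/
def restrictClause (σ : Sub) (C : Clause) : Clause :=
  C.biUnion (fun l => match appLit σ l with
    | .inr m => {m}
    | _ => (∅ : Clause))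

/-- `Γ↾σ` : restrict every clause of `Γ`; clauses mapped to `1` are removed. -/
def restrictCNF (σ : Sub) (Γ : CNF) : CNF :=
  (Γ.filter (fun C => ¬ clauseTrue σ C)).map (restrictClause σ)

/-- `σ ⊨ C` : `σ(C) = 1` or `σ(C)` is tautological. -/
def subSat (σ : Sub) (C : Clause) : Prop :=
  clauseTrue σ C ∨ isTaut (restrictClause σ C)

/-- The assignment `¬C`, setting all literals of `C` to false. -/
def negSub (C : Clause) : Sub := fun v =>
  if (v, true) ∈ C then .inl false
  else if (v, false) ∈ C then .inl true
  else .inr (v, true)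

/-- The substitution setting the literal `l` to true and touching nothing else. -/
def litSub (l : Lit) : Sub := fun v => if v = l.1 then .inl l.2 else .inr (v, true)

/-- Unit propagation derives the empty clause. -/
inductive UPFalse : CNF → Prop
  | empty {Γ : CNF} : (∅ : Clause) ∈ Γ → UPFalse Γ
  | step {Γ : CNF} (l : Lit) : ({l} : Clause) ∈ Γ →
      UPFalse (restrictCNF (litSub l) Γ) → UPFalse Γ

/-- The unit clauses `¬l` for `l ∈ C`. -/
def negUnits (C : Clause) : CNF := C.val.map (fun l => ({negLit l} : Clause))

/-- `Γ ⊢₁ C` : unit propagation on `Γ↾¬C` produces the empty clause. -/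
def UPimplies (Γ : CNF) (C : Clause) : Prop := UPFalse (Γ + negUnits C)

/-- `Γ ⊢₁ Δ` : `Γ ⊢₁ D` for every `D ∈ Δ`. -/
def UPimpliesAll (Γ Δ : CNF) : Prop := ∀ D ∈ Δ, UPimplies Γ D

/-- Total assignments. -/
abbrev TAssign := Var → Bool

/-- A total assignment satisfies a clause. -/
def satC (α : TAssign) (C : Clause) : Prop := ∃ l ∈ C, α l.1 = l.2

instance (α : TAssign) (C : Clause) : Decidable (satC α C) := by
  unfold satC; infer_instance

/-- A total assignment satisfies a CNF. -/
def satCNF (α : TAssign) (Γ : CNF) : Prop := ∀ C ∈ Γ, satC α C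

/-- `τ ∘ σ` : composition of a total assignment with a substitution. -/
def comp (τ : TAssign) (σ : Sub) : TAssign := fun v =>
  match σ v with
  | .inl b => b
  | .inr l => if l.2 then τ l.1 else !(τ l.1)

/-- `τ` extends the assignment `¬C`. -/
def extendsNeg (τ : TAssign) (C : Clause) : Prop := ∀ l ∈ C, τ l.1 = !l.2

/-- The cost of a total assignment w.r.t. a set `B` of blocking variables:
the number of blocking variables set to true. -/
def cost (B : Finset Var) (α : TAssign) : ℕ := (B.filter (fun b => α b = true)).card

/-- The cost of a MaxSAT instance encoded with blocking variables `B`: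
the minimum cost of a satisfying total assignment. -/
noncomputable def costCNF (B : Finset Var) (Γ : CNF) : ℕ :=
  sInf {k | ∃ α : TAssign, satCNF α Γ ∧ cost B α = k}

/-- `σ` witnesses that `C` is cost-SR w.r.t. `Γ` (with blocking variables `B`):
the redundancy condition `Γ↾¬C ⊢₁ (Γ ∪ {C})↾σ` and the cost condition. -/
def CostSRwit (B : Finset Var) (Γ : CNF) (C : Clause) (σ : Sub) : Prop :=
  UPimpliesAll (restrictCNF (negSub C) Γ) (restrictCNF σ (C ::ₘ Γ)) ∧
  ∀ τ : TAssign, extendsNeg τ C → cost B (comp τ σ) ≤ cost B τ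

/-- `C` is cost-SR w.r.t. `Γ`. -/
def CostSR (B : Finset Var) (Γ : CNF) (C : Clause) : Prop := ∃ σ, CostSRwit B Γ C σ

/-- A substitution which is an assignment: every value is `0`, `1`,
or the variable itself. -/
def isAssign (σ : Sub) : Prop :=
  ∀ v, σ v = .inl true ∨ σ v = .inl false ∨ σ v = .inr (v, true)

/-- The variables of a clause. -/
def varsClause (C : Clause) : Finset Var := C.image Prod.fst

/-- The variables of a CNF. -/
def varsCNF (Γ : CNF) : Finset Var := (Γ.map varsClause).sup

/-- Membership in the domain of an assignment. -/
def subDom (σ : Sub) (v : Var) : Prop := ∃ b : Bool, σ v = .inl b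

/-- `C` is cost-PR w.r.t. `Γ`: cost-SR witnessed by an assignment. -/
def CostPR (B : Finset Var) (Γ : CNF) (C : Clause) : Prop :=
  ∃ σ, CostSRwit B Γ C σ ∧ isAssign σ

/-- `C` is cost-SPR w.r.t. `Γ`: cost-SR witnessed by an assignment with
domain `dom(¬C) = Var(C)`. -/
def CostSPR (B : Finset Var) (Γ : CNF) (C : Clause) : Prop :=
  ∃ σ, CostSRwit B Γ C σ ∧ isAssign σ ∧ (∀ v, subDom σ v ↔ v ∈ varsClause C)

/-- `C` is cost-LPR w.r.t. `Γ`: cost-SR witnessed by an assignment with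
domain `dom(¬C)` differing from `¬C` on exactly one variable. -/
def CostLPR (B : Finset Var) (Γ : CNF) (C : Clause) : Prop :=
  ∃ σ, CostSRwit B Γ C σ ∧ isAssign σ ∧ (∀ v, subDom σ v ↔ v ∈ varsClause C) ∧
    ((varsClause C).filter (fun v => σ v ≠ negSub C v)).card = 1

/-- `D` is a resolvent of `E₁` and `E₂`. -/
def resolvent (D E₁ E₂ : Clause) : Prop :=
  ∃ x : Var, (x, true) ∈ E₁ ∧ (x, false) ∈ E₂ ∧
    D = E₁.erase (x, true) ∪ E₂.erase (x, false)

/-- A derivation from `Γ` in the calculus with redundancy rule `Red`: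
every clause of the list is in `Γ`, a weakening of an earlier clause,
a resolvent of two earlier clauses, or redundant (w.r.t. `Red`) relative to
`Γ` together with the earlier clauses, using no new variables. -/
def IsDeriv (Red : Finset Var → CNF → Clause → Prop) (B : Finset Var) (Γ : CNF)
    (L : List Clause) : Prop :=
  ∀ i, ∀ hi : i < L.length,
    L[i] ∈ Γ ∨
    (∃ j, ∃ hj : j < i, L[j]'(hj.trans hi) ⊆ L[i]) ∨
    (∃ j k, ∃ hj : j < i, ∃ hk : k < i,
      resolvent L[i] (L[j]'(hj.trans hi)) (L[k]'(hk.trans hi))) ∨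
    (Red B (Γ + (↑(L.take i) : CNF)) L[i] ∧ varsClause L[i] ⊆ varsCNF Γ)

/-- `C ∨ ℓ` is a cost blocked clause (cost-BC) w.r.t. `Γ` and `ℓ`. -/
def CostBC (B : Finset Var) (Γ : CNF) (C : Clause) (l : Lit) : Prop :=
  (∀ D ∈ Γ, negLit l ∈ D → isTaut (C ∪ D.erase (negLit l))) ∧
  ¬(l.2 = true ∧ l.1 ∈ B)

/-- Hamming distance between two total assignments, over the variables in `V`. -/
def HD (V : Finset Var) (α β : TAssign) : ℕ := (V.filter (fun v => α v ≠ β v)).card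

/-- `flip(C, σ) ≥ d` : some total assignment `τ` extending `¬C` has
Hamming distance (over `V`) at least `d` from `τ ∘ σ`. -/
def flipGE (V : Finset Var) (C : Clause) (σ : Sub) (d : ℕ) : Prop :=
  ∃ τ : TAssign, extendsNeg τ C ∧ d ≤ HD V τ (comp τ σ)


/-- The variable `p_{i,j}` ("pigeon `i` flies to hole `j`"). -/
def pV (i j : ℕ) : Var := 3 * Nat.pair i j
/-- The blocking variable `b_i` of the totality clause for pigeon `i`. -/
def bTot (i : ℕ) : Var := 3 * i + 1
/-- The blocking variable `b_{i,k,j}` of the injectivity clause for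
pigeons `i < k` and hole `j`. -/
def bInj (i k j : ℕ) : Var := 3 * Nat.pair i (Nat.pair k j) + 2

/-- The totality clause `⋁_{j∈[n]} p_{i,j} ∨ b_i`. -/
def totClause (n i : ℕ) : Clause :=
  insert (bTot i, true) ((Finset.range n).image fun j => ((pV i (j+1), true) : Lit))

/-- The triples `(i-1, k-1, j-1)` with `1 ≤ i < k ≤ m` and `j ∈ [n]`. -/
def injTriples (m n : ℕ) : Finset (ℕ × ℕ × ℕ) :=
  (Finset.range m ×ˢ Finset.range m ×ˢ Finset.range n).filter fun t => t.1 < t.2.1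

/-- The injectivity clause `¬p_{i,j} ∨ ¬p_{k,j} ∨ b_{i,k,j}` for the triple
`t = (i-1, k-1, j-1)`. -/
def injClause (t : ℕ × ℕ × ℕ) : Clause :=
  { ((pV (t.1+1) (t.2.2+1), false) : Lit),
    ((pV (t.2.1+1) (t.2.2+1), false) : Lit),
    ((bInj (t.1+1) (t.2.1+1) (t.2.2+1), true) : Lit) }

/-- The blocking-variable weak pigeonhole principle `BPHP(m,n)`. -/
def BPHP (m n : ℕ) : CNF :=
  ((Finset.range m).val.map fun i => totClause n (i+1)) +
  ((injTriples m n).val.map injClause)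

/-- The blocking variables of `BPHP(m,n)`. -/
def BPHPblocking (m n : ℕ) : Finset Var :=
  ((Finset.range m).image fun i => bTot (i+1)) ∪
  ((injTriples m n).image fun t => bInj (t.1+1) (t.2.1+1) (t.2.2+1))

/-! ### General facts about restrictions, unit propagation and derivations -/

lemma mem_restrictCNF {σ : Sub} {Γ : CNF} {D : Clause} :
    D ∈ restrictCNF σ Γ ↔ ∃ E ∈ Γ, ¬ clauseTrue σ E ∧ restrictClause σ E = D := by
  simp [restrictCNF, and_assoc]

lemma mem_restrictClause {σ : Sub} {E : Clause} {l : Lit} :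
    l ∈ restrictClause σ E ↔ ∃ l₀ ∈ E, appLit σ l₀ = .inr l := by
  simp only [restrictClause, Finset.mem_biUnion]
  refine exists_congr fun l₀ => and_congr_right fun _ => ?_
  cases appLit σ l₀ <;> simp [eq_comm]

@[simp] lemma negLit_negLit (l : Lit) : negLit (negLit l) = l := by simp [negLit]

lemma negLit_ne (l : Lit) : negLit l ≠ l := by simp [negLit, Prod.ext_iff]

lemma appLit_litSub_self (l : Lit) : appLit (litSub l) l = .inl true := by
  obtain ⟨v, b⟩ := l
  cases b <;> simp [appLit, litSub, negSV]

lemma appLit_litSub_neg (l : Lit) : appLit (litSub l) (negLit l) = .inl false := by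
  obtain ⟨v, b⟩ := l
  cases b <;> simp [appLit, litSub, negSV, negLit]

lemma appLit_litSub_of_ne {l l' : Lit} (h₁ : l' ≠ l) (h₂ : l' ≠ negLit l) :
    appLit (litSub l) l' = .inr l' := by
  obtain ⟨v, b⟩ := l
  obtain ⟨v', b'⟩ := l'
  have hv : v' ≠ v := by
    rintro rfl
    cases b <;> cases b' <;> simp [negLit] at h₁ h₂
  cases b' <;> simp [appLit, litSub, negSV, negLit, hv]

/-- Two complementary unit clauses are refuted by unit propagation. -/
lemma UPFalse.of_complementary {Γ : CNF} {l : Lit} (h₁ : ({l} : Clause) ∈ Γ)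
    (h₂ : ({negLit l} : Clause) ∈ Γ) : UPFalse Γ := by
  refine .step l h₁ (.empty (mem_restrictCNF.2 ⟨_, h₂, ?_, ?_⟩))
  · simp [clauseTrue, appLit_litSub_neg]
  · ext x
    simp [mem_restrictClause, appLit_litSub_neg]

/-- A clause all of whose literals are falsified by unit clauses is refuted by unit propagation. -/
lemma UPFalse.of_falsified {Γ : CNF} {E : Clause} (hE : E ∈ Γ)
    (h : ∀ l ∈ E, ({negLit l} : Clause) ∈ Γ) : UPFalse Γ := by
  induction E using Finset.strongInduction generalizing Γ with
  | H E ih =>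
  rcases E.eq_empty_or_nonempty with rfl | ⟨l, hl⟩
  · exact .empty hE
  by_cases hn : negLit l ∈ E
  · exact .of_complementary (h l hl) (h _ hn)
  have key : ∀ x ∈ E.erase l, appLit (litSub (negLit l)) x = .inr x := fun x hx =>
    appLit_litSub_of_ne (fun e => hn (e ▸ Finset.mem_of_mem_erase hx))
      (by simpa using Finset.ne_of_mem_erase hx)
  have hfalse : appLit (litSub (negLit l)) l = .inl false := by
    simpa using appLit_litSub_neg (negLit l)
  refine .step (negLit l) (h l hl) (ih (E.erase l) (Finset.erase_ssubset hl) ?_ ?_)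
  · refine mem_restrictCNF.2 ⟨E, hE, ?_, ?_⟩
    · rintro ⟨x, hx, hxt⟩
      by_cases e : x = l
      · simp [e, hfalse] at hxt
      · simp [key x (Finset.mem_erase.2 ⟨e, hx⟩)] at hxt
    · ext y
      rw [mem_restrictClause]
      constructor
      · rintro ⟨x, hx, hxy⟩
        by_cases e : x = l
        · simp [e, hfalse] at hxy
        · have hx' := Finset.mem_erase.2 ⟨e, hx⟩
          rw [key x hx'] at hxy
          exact Sum.inr.inj hxy ▸ hx'
      · exact fun hy => ⟨y, Finset.mem_of_mem_erase hy, key y hy⟩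
  · intro x hx
    have hne : negLit x ≠ negLit l := fun e =>
      Finset.ne_of_mem_erase hx (by simpa using congrArg negLit e)
    have hne' : negLit x ≠ negLit (negLit l) := fun e => hn (by
      have : x = negLit l := by simpa using congrArg negLit e
      exact this ▸ Finset.mem_of_mem_erase hx)
    have := appLit_litSub_of_ne hne hne'
    refine mem_restrictCNF.2 ⟨_, h x (Finset.mem_of_mem_erase hx), ?_, ?_⟩
    · simp [clauseTrue, this]
    · ext y
      simp [mem_restrictClause, this, eq_comm]

lemma mem_negUnits {C D : Clause} : D ∈ negUnits C ↔ ∃ l ∈ C, {negLit l} = D := by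
  simp [negUnits]

lemma appLit_negSub_mem {C : Clause} (hC : ∀ l ∈ C, negLit l ∉ C) {l : Lit} (h : l ∈ C) :
    appLit (negSub C) l = .inl false := by
  obtain ⟨v, b⟩ := l
  have := hC _ h
  cases b <;> simp_all [appLit, negSub, negSV, negLit]

lemma appLit_negSub_of_notMem {C : Clause} {l : Lit} (h₁ : l ∉ C) (h₂ : negLit l ∉ C) :
    appLit (negSub C) l = .inr l := by
  obtain ⟨v, b⟩ := l
  cases b <;> simp_all [appLit, negSub, negSV, negLit]

/-- A criterion for cost-SR in which every unit propagation falsifies a clause of `Γ` using only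
unit clauses of `Γ↾¬C`. -/
lemma CostSR.intro {B : Finset Var} {Γ : CNF} {C : Clause} (σ : Sub)
    (hC : ∀ l ∈ C, negLit l ∉ C)
    (hred : ∀ E₀, E₀ = C ∨ E₀ ∈ Γ → ¬ clauseTrue σ E₀ → ∃ E ∈ Γ, ∀ l ∈ E, negLit l ∉ C ∧
      (l ∈ C ∨ (∃ l₀ ∈ E₀, appLit σ l₀ = .inr l) ∨
        ∃ U ∈ Γ, negLit l ∈ U ∧ U ⊆ insert (negLit l) C))
    (hcost : ∀ τ : TAssign, extendsNeg τ C → cost B (comp τ σ) ≤ cost B τ) :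
    CostSR B Γ C := by
  refine ⟨σ, fun D hD => ?_, hcost⟩
  obtain ⟨E₀, hE₀, hnt, rfl⟩ := mem_restrictCNF.1 hD
  obtain ⟨E, hE, h⟩ := hred E₀ (by simpa using hE₀) hnt
  have happ : ∀ l, negLit l ∉ C → l ∉ C → appLit (negSub C) l = .inr l :=
    fun l h₁ h₂ => appLit_negSub_of_notMem h₂ h₁
  refine UPFalse.of_falsified (E := restrictClause (negSub C) E)
    (Multiset.mem_add.2 (.inl (mem_restrictCNF.2 ⟨E, hE, ?_, rfl⟩))) ?_
  · rintro ⟨l, hl, hlt⟩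
    by_cases hlC : l ∈ C
    · simp [appLit_negSub_mem hC hlC] at hlt
    · simp [happ l (h l hl).1 hlC] at hlt
  · intro l' hl'
    obtain ⟨l, hl, hll⟩ := mem_restrictClause.1 hl'
    obtain ⟨hneg, hcases⟩ := h l hl
    by_cases hlC : l ∈ C
    · simp [appLit_negSub_mem hC hlC] at hll
    rw [happ l hneg hlC] at hll
    obtain rfl := Sum.inr.inj hll
    rw [Multiset.mem_add]
    rcases hcases with h₁ | h₁ | ⟨U, hU, hlU, hUC⟩
    · exact absurd h₁ hlC
    · exact .inr (mem_negUnits.2 ⟨l, mem_restrictClause.2 h₁, rfl⟩)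
    · have hn : appLit (negSub C) (negLit l) = .inr (negLit l) :=
        happ _ (by simpa using hlC) hneg
      refine .inl (mem_restrictCNF.2 ⟨U, hU, ?_, ?_⟩)
      · rintro ⟨x, hx, hxt⟩
        rcases Finset.mem_insert.1 (hUC hx) with rfl | hxC
        · simp [hn] at hxt
        · simp [appLit_negSub_mem hC hxC] at hxt
      · ext y
        rw [mem_restrictClause, Finset.mem_singleton]
        constructor
        · rintro ⟨x, hx, hxy⟩
          rcases Finset.mem_insert.1 (hUC hx) with rfl | hxC
          · rw [hn] at hxy
            exact (Sum.inr.inj hxy).symm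
          · simp [appLit_negSub_mem hC hxC] at hxy
        · rintro rfl
          exact ⟨_, hlU, hn⟩

/-- Clauses derivable by unit propagation are cost-SR. -/
lemma CostSR.of_falsified {B : Finset Var} {Γ : CNF} {C E : Clause}
    (hC : ∀ l ∈ C, negLit l ∉ C) (hE : E ∈ Γ)
    (h : ∀ l ∈ E, negLit l ∉ C ∧ (l ∈ C ∨ ({negLit l} : Clause) ∈ Γ)) : CostSR B Γ C := by
  refine .intro idSub hC (fun E₀ _ _ => ⟨E, hE, fun l hl => ⟨(h l hl).1, ?_⟩⟩) fun τ _ => ?_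
  · rcases (h l hl).2 with h' | h'
    · exact .inl h'
    · exact .inr (.inr ⟨_, h', by simp, by simp⟩)
  · exact le_of_eq rfl

lemma restrictCNF_mem_congr {Γ Δ : CNF} (h : ∀ E, E ∈ Γ ↔ E ∈ Δ) (σ : Sub) (D : Clause) :
    D ∈ restrictCNF σ Γ ↔ D ∈ restrictCNF σ Δ := by
  simp [mem_restrictCNF, h]

lemma UPFalse.of_mem {Γ Δ : CNF} (hΓ : UPFalse Γ) (h : ∀ E ∈ Γ, E ∈ Δ) : UPFalse Δ := by
  induction hΓ generalizing Δ with
  | empty h' => exact .empty (h _ h')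
  | step l h' _ ih =>
    refine .step l (h _ h') (ih fun E hE => ?_)
    obtain ⟨D, hD, hE⟩ := mem_restrictCNF.1 hE
    exact mem_restrictCNF.2 ⟨D, h _ hD, hE⟩

lemma CostSR.congr {B : Finset Var} {Γ Δ : CNF} {C : Clause} (hΓ : CostSR B Γ C)
    (h : ∀ E, E ∈ Γ ↔ E ∈ Δ) : CostSR B Δ C := by
  obtain ⟨σ, h₁, h₂⟩ := hΓ
  refine ⟨σ, fun D hD => ?_, h₂⟩
  refine (h₁ D ((restrictCNF_mem_congr (by simp [h]) σ D).2 hD)).of_mem fun E hE => ?_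
  rw [Multiset.mem_add, restrictCNF_mem_congr h] at hE
  exact Multiset.mem_add.2 hE

/-- Some cost-SR derivation from `Γ` without repetitions consists exactly of the clauses in `S`. -/
def Derivable (B : Finset Var) (Γ : CNF) (S : Finset Clause) : Prop :=
  ∃ L : List Clause, IsDeriv CostSR B Γ L ∧ L.Nodup ∧ L.toFinset = S

lemma Derivable.empty (B : Finset Var) (Γ : CNF) : Derivable B Γ ∅ :=
  ⟨[], fun i hi => absurd hi (by simp), by simp, by simp⟩

lemma IsDeriv.append_singleton {B : Finset Var} {Γ : CNF} {L : List Clause} {C : Clause}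
    (hL : IsDeriv CostSR B Γ L) (hC : CostSR B (Γ + (↑L : CNF)) C)
    (hv : varsClause C ⊆ varsCNF Γ) : IsDeriv CostSR B Γ (L ++ [C]) := by
  intro i hi
  rcases lt_or_ge i L.length with h | h
  · have hget : ∀ j (hj : j < L.length) (hj' : j < (L ++ [C]).length),
        (L ++ [C])[j] = L[j] := fun j hj _ => List.getElem_append_left hj
    rcases hL i h with h₁ | ⟨j, hj, h₁⟩ | ⟨j, k, hj, hk, h₁⟩ | h₁
    · exact .inl (by rwa [hget i h])
    · exact .inr (.inl ⟨j, hj, by rwa [hget i h, hget j (hj.trans h)]⟩)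
    · exact .inr (.inr (.inl ⟨j, k, hj, hk, by
        rwa [hget i h, hget j (hj.trans h), hget k (hk.trans h)]⟩))
    · exact .inr (.inr (.inr (by
        rwa [hget i h, List.take_append_of_le_length h.le])))
  · obtain rfl : i = L.length := by
      simp only [List.length_append, List.length_singleton] at hi
      omega
    exact .inr (.inr (.inr (by simpa using ⟨hC, hv⟩)))

lemma Derivable.insert {B : Finset Var} {Γ : CNF} {S : Finset Clause} {C : Clause}
    (hS : Derivable B Γ S) (hC : CostSR B (Γ + S.val) C) (hv : varsClause C ⊆ varsCNF Γ) :
    Derivable B Γ (insert C S) := by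
  by_cases hCS : C ∈ S
  · rwa [Finset.insert_eq_of_mem hCS]
  obtain ⟨L, hL, hn, rfl⟩ := hS
  refine ⟨L ++ [C], hL.append_singleton (hC.congr fun E => by simp) hv, ?_, ?_⟩
  · simp only [List.mem_toFinset] at hCS
    rw [List.nodup_append]
    refine ⟨hn, List.nodup_singleton _, fun a ha b hb e => hCS ?_⟩
    rw [List.mem_singleton] at hb
    exact hb ▸ e ▸ ha
  · ext E
    simp

/-- A family of clauses can be added in any order, provided that each of them is cost-SR
in the presence of any other clauses of the family. -/
lemma Derivable.union {B : Finset Var} {Γ : CNF} {S F : Finset Clause}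
    (hS : Derivable B Γ S) (hF : ∀ F' ⊆ F, ∀ C ∈ F, CostSR B (Γ + (S ∪ F').val) C)
    (hv : ∀ C ∈ F, varsClause C ⊆ varsCNF Γ) : Derivable B Γ (S ∪ F) := by
  suffices h : ∀ F' ⊆ F, Derivable B Γ (S ∪ F') from h F subset_rfl
  intro F'
  induction F' using Finset.induction_on with
  | empty => simpa using hS
  | insert C F' _ ih =>
    intro hsub
    have hC := hsub (Finset.mem_insert_self C F')
    have hF' := (Finset.subset_insert C F').trans hsub
    rw [Finset.union_insert]
    exact (ih hF').insert (hF F' hF' C hC) (hv C hC)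

/-! ### Variables and clauses of `BPHP` -/

@[simp] lemma pV_inj {i j i' j' : ℕ} : pV i j = pV i' j' ↔ i = i' ∧ j = j' := by
  simp [pV, Nat.pair_eq_pair]

@[simp] lemma bTot_inj {i i' : ℕ} : bTot i = bTot i' ↔ i = i' := by simp [bTot]

@[simp] lemma bInj_inj {i k j i' k' j' : ℕ} :
    bInj i k j = bInj i' k' j' ↔ i = i' ∧ k = k' ∧ j = j' := by
  simp [bInj, Nat.pair_eq_pair]

@[simp] lemma pV_ne_bTot {i j k : ℕ} : pV i j ≠ bTot k := fun h => by
  have : 3 * Nat.pair i j = 3 * k + 1 := h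
  omega
@[simp] lemma bTot_ne_pV {i j k : ℕ} : bTot k ≠ pV i j := pV_ne_bTot.symm
@[simp] lemma pV_ne_bInj {a b i k j : ℕ} : pV a b ≠ bInj i k j := fun h => by
  have : 3 * Nat.pair a b = 3 * Nat.pair i (Nat.pair k j) + 2 := h
  omega
@[simp] lemma bInj_ne_pV {a b i k j : ℕ} : bInj i k j ≠ pV a b := pV_ne_bInj.symm
@[simp] lemma bTot_ne_bInj {a i k j : ℕ} : bTot a ≠ bInj i k j := fun h => by
  have : 3 * a + 1 = 3 * Nat.pair i (Nat.pair k j) + 2 := h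
  omega
@[simp] lemma bInj_ne_bTot {a i k j : ℕ} : bInj i k j ≠ bTot a := bTot_ne_bInj.symm

lemma mem_totClause {n i : ℕ} {l : Lit} :
    l ∈ totClause n i ↔ l = (bTot i, true) ∨ ∃ j, 1 ≤ j ∧ j ≤ n ∧ l = (pV i j, true) := by
  simp only [totClause, Finset.mem_insert, Finset.mem_image, Finset.mem_range]
  refine or_congr_right ⟨?_, ?_⟩
  · rintro ⟨j, hj, rfl⟩
    exact ⟨j + 1, by omega, by omega, rfl⟩
  · rintro ⟨j, hj, hjn, rfl⟩
    exact ⟨j - 1, by omega, by rw [Nat.sub_add_cancel hj]⟩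

lemma mem_injTriples_image {α : Type*} [DecidableEq α] {m n : ℕ} (f : ℕ → ℕ → ℕ → α) {x : α} :
    x ∈ (injTriples m n).image (fun t => f (t.1 + 1) (t.2.1 + 1) (t.2.2 + 1)) ↔
      ∃ i k j, 1 ≤ i ∧ i < k ∧ k ≤ m ∧ 1 ≤ j ∧ j ≤ n ∧ x = f i k j := by
  simp only [injTriples, Finset.mem_image, Finset.mem_filter, Finset.mem_product, Finset.mem_range]
  constructor
  · rintro ⟨⟨i, k, j⟩, h, rfl⟩
    simp only at h
    exact ⟨i + 1, k + 1, j + 1, by omega, by omega, by omega, by omega, by omega, rfl⟩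
  · rintro ⟨i, k, j, hi, hik, hk, hj, hjn, rfl⟩
    refine ⟨(i - 1, k - 1, j - 1), by simp only; omega, ?_⟩
    simp only
    rw [Nat.sub_add_cancel hi, Nat.sub_add_cancel (by omega), Nat.sub_add_cancel hj]

lemma mem_range_image {α : Type*} [DecidableEq α] {m : ℕ} (f : ℕ → α) {x : α} :
    x ∈ (Finset.range m).image (fun i => f (i + 1)) ↔ ∃ i, 1 ≤ i ∧ i ≤ m ∧ x = f i := by
  simp only [Finset.mem_image, Finset.mem_range]
  constructor
  · rintro ⟨i, hi, rfl⟩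
    exact ⟨i + 1, by omega, by omega, rfl⟩
  · rintro ⟨i, hi, him, rfl⟩
    exact ⟨i - 1, by omega, by rw [Nat.sub_add_cancel hi]⟩

lemma mem_BPHP {m n : ℕ} {E : Clause} :
    E ∈ BPHP m n ↔ (∃ i, 1 ≤ i ∧ i ≤ m ∧ E = totClause n i) ∨
      ∃ i k j, 1 ≤ i ∧ i < k ∧ k ≤ m ∧ 1 ≤ j ∧ j ≤ n ∧
        E = {(pV i j, false), (pV k j, false), (bInj i k j, true)} := by
  rw [← mem_range_image (totClause n), ← mem_injTriples_image
    fun i k j => ({(pV i j, false), (pV k j, false), (bInj i k j, true)} : Clause)]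
  simp only [BPHP, Multiset.mem_add, Finset.mem_image, Multiset.mem_map, Finset.mem_val]
  rfl

lemma mem_BPHPblocking {m n b : ℕ} :
    b ∈ BPHPblocking m n ↔ (∃ i, 1 ≤ i ∧ i ≤ m ∧ b = bTot i) ∨
      ∃ i k j, 1 ≤ i ∧ i < k ∧ k ≤ m ∧ 1 ≤ j ∧ j ≤ n ∧ b = bInj i k j := by
  rw [BPHPblocking, Finset.mem_union, mem_range_image bTot, mem_injTriples_image bInj]

lemma mem_varsCNF_of_mem {Γ : CNF} {E : Clause} (hE : E ∈ Γ) {l : Lit} (hl : l ∈ E) :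
    l.1 ∈ varsCNF Γ :=
  Multiset.le_sup (Multiset.mem_map_of_mem varsClause hE) (Finset.mem_image_of_mem _ hl)

lemma pV_mem_vars {m n i j : ℕ} (hi : 1 ≤ i) (him : i ≤ m) (hj : 1 ≤ j) (hjn : j ≤ n) :
    pV i j ∈ varsCNF (BPHP m n) :=
  mem_varsCNF_of_mem (mem_BPHP.2 (.inl ⟨i, hi, him, rfl⟩)) (l := (pV i j, true))
    (mem_totClause.2 (.inr ⟨j, hj, hjn, rfl⟩))

lemma bTot_mem_vars {m n i : ℕ} (hi : 1 ≤ i) (him : i ≤ m) :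
    bTot i ∈ varsCNF (BPHP m n) :=
  mem_varsCNF_of_mem (mem_BPHP.2 (.inl ⟨i, hi, him, rfl⟩)) (l := (bTot i, true))
    (mem_totClause.2 (.inl rfl))

lemma bInj_mem_vars {m n i k j : ℕ} (hi : 1 ≤ i) (hik : i < k) (hk : k ≤ m) (hj : 1 ≤ j)
    (hjn : j ≤ n) : bInj i k j ∈ varsCNF (BPHP m n) :=
  mem_varsCNF_of_mem (mem_BPHP.2 (.inr ⟨i, k, j, hi, hik, hk, hj, hjn, rfl⟩))
    (l := (bInj i k j, true)) (by simp)

@[simp] lemma appLit_true {σ : Sub} {v : Var} : appLit σ (v, true) = σ v := rfl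

@[simp] lemma appLit_false {σ : Sub} {v : Var} : appLit σ (v, false) = negSV (σ v) := rfl

lemma appLit_eq_self {σ : Sub} {l : Lit} (h : σ l.1 = .inr (l.1, true)) :
    appLit σ l = .inr l := by
  obtain ⟨v, b⟩ := l
  cases b <;> simp_all [negSV, negLit]

lemma bInj_mod (i k j : ℕ) : bInj i k j % 3 = 2 :=
  Nat.mul_add_mod 3 (Nat.pair i (Nat.pair k j)) 2

lemma ne_pV_of_mod {v : Var} (hv : v % 3 = 2) (i j : ℕ) : v ≠ pV i j := by
  rintro rfl
  have : pV i j % 3 = 0 := Nat.mul_mod_right 3 _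
  exact absurd (this.symm.trans hv) (by norm_num)

/-- `Untouched σ E` : the substitution `σ` is the identity on the variables of `E`. -/
def Untouched (σ : Sub) (E : Clause) : Prop := ∀ l ∈ E, σ l.1 = .inr (l.1, true)

lemma Untouched.exists_falsified {σ : Sub} {Γ : CNF} {C E : Clause} (h : Untouched σ E)
    (hE : E ∈ Γ) (hC : ∀ l ∈ E, negLit l ∉ C) :
    ∃ E' ∈ Γ, ∀ l ∈ E', negLit l ∉ C ∧
      (l ∈ C ∨ (∃ l₀ ∈ E, appLit σ l₀ = .inr l) ∨
        ∃ U ∈ Γ, negLit l ∈ U ∧ U ⊆ insert (negLit l) C) :=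
  ⟨E, hE, fun l hl => ⟨hC l hl, .inr (.inl ⟨l, hl, appLit_eq_self (h l hl)⟩)⟩⟩

/-! ### The derivation -/

/-- The unit clauses `¬b_{i,k,j}`. -/
def negInj (m n : ℕ) : Finset Clause :=
  (injTriples m n).image fun t => {((bInj (t.1 + 1) (t.2.1 + 1) (t.2.2 + 1), false) : Lit)}

lemma mem_negInj {m n : ℕ} {E : Clause} :
    E ∈ negInj m n ↔ ∃ i k j, 1 ≤ i ∧ i < k ∧ k ≤ m ∧ 1 ≤ j ∧ j ≤ n ∧
      E = {(bInj i k j, false)} :=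
  mem_injTriples_image fun i k j => ({(bInj i k j, false)} : Clause)

/-- Empty hole `j` of pigeon `i`, pay for the totality of `i`, and release `b_{i,k,j}`. -/
def releaseSub (i k j : ℕ) : Sub := fun v =>
  if v = pV i j ∨ v = bInj i k j then .inl false
  else if v = bTot i then .inl true else .inr (v, true)

lemma cost_releaseSub {B : Finset Var} {i k j : ℕ} (hB : bInj i k j ∈ B) {τ : TAssign}
    (hτ : τ (bInj i k j) = true) : cost B (comp τ (releaseSub i k j)) ≤ cost B τ := by
  have hmem : bInj i k j ∈ B.filter (fun b => τ b = true) := by simp [hB, hτ]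
  calc cost B (comp τ (releaseSub i k j))
      ≤ (insert (bTot i) ((B.filter (fun b => τ b = true)).erase (bInj i k j))).card := by
        refine Finset.card_le_card fun v hv => ?_
        obtain ⟨hvB, hv⟩ := Finset.mem_filter.1 hv
        simp only [comp, releaseSub] at hv
        simp only [Finset.mem_insert, Finset.mem_erase, Finset.mem_filter]
        split_ifs at hv <;> simp_all
    _ ≤ ((B.filter (fun b => τ b = true)).erase (bInj i k j)).card + 1 :=
        Finset.card_insert_le _ _
    _ = cost B τ := Finset.card_erase_add_one hmem

lemma costSR_negInj {m n i k j : ℕ} (hi : 1 ≤ i) (hik : i < k) (hk : k ≤ m) (hj : 1 ≤ j)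
    (hjn : j ≤ n) {S : Finset Clause} (hS : S ⊆ negInj m n) :
    CostSR (BPHPblocking m n) (BPHP m n + S.val) {(bInj i k j, false)} := by
  refine .intro (releaseSub i k j) (by simp [negLit]) (fun E hE hnt => ?_) fun τ hτ =>
    cost_releaseSub (mem_BPHPblocking.2 (.inr ⟨i, k, j, hi, hik, hk, hj, hjn, rfl⟩))
      (by simpa using hτ (bInj i k j, false))
  rw [Multiset.mem_add, mem_BPHP] at hE
  have hCt : clauseTrue (releaseSub i k j) {(bInj i k j, false)} := by
    simp [clauseTrue, releaseSub, negSV]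
  rcases hE with rfl | (⟨a, ha, ham, rfl⟩ | ⟨a, b, c, ha, hab, hb, hc, hcn, rfl⟩) | hE
  · exact absurd hCt hnt
  · have hai : a ≠ i := by
      rintro rfl
      exact hnt ⟨_, mem_totClause.2 (.inl rfl), by simp [releaseSub]⟩
    refine Untouched.exists_falsified ?_ (Multiset.mem_add.2 (.inl (mem_BPHP.2
      (.inl ⟨a, ha, ham, rfl⟩)))) ?_
    · intro l hl
      rcases mem_totClause.1 hl with rfl | ⟨c, -, -, rfl⟩ <;> simp [releaseSub, hai]
    · intro l hl
      rcases mem_totClause.1 hl with rfl | ⟨c, -, -, rfl⟩ <;> simp [negLit]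
  · simp only [clauseTrue, Finset.mem_insert, Finset.mem_singleton, exists_eq_or_imp,
      exists_eq_left, not_or, appLit_false, appLit_true] at hnt
    have h₁ : ¬ (a = i ∧ c = j) := fun h => hnt.1 (by simp [releaseSub, h, negSV])
    have h₂ : ¬ (b = i ∧ c = j) := fun h => hnt.2.1 (by simp [releaseSub, h, negSV])
    refine Untouched.exists_falsified ?_ (Multiset.mem_add.2 (.inl (mem_BPHP.2
      (.inr ⟨a, b, c, ha, hab, hb, hc, hcn, rfl⟩)))) ?_
    · have h₃ : ¬ (a = i ∧ b = k ∧ c = j) := by tauto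
      simp [Untouched, releaseSub, h₁, h₂, h₃]
    · have h₃ : ¬ (a = i ∧ b = k ∧ c = j) := by tauto
      simp [negLit, h₃]
  · obtain ⟨a, b, c, -, -, -, -, -, rfl⟩ := mem_negInj.1 (hS hE)
    by_cases h : a = i ∧ b = k ∧ c = j
    · obtain ⟨rfl, rfl, rfl⟩ := h
      exact absurd hCt hnt
    · exact Untouched.exists_falsified (by simp [Untouched, releaseSub, h])
        (Multiset.mem_add.2 (.inr hE)) (by simp [negLit])

lemma derivable_negInj (m n : ℕ) : Derivable (BPHPblocking m n) (BPHP m n) (negInj m n) := by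
  have := (Derivable.empty (BPHPblocking m n) (BPHP m n)).union (F := negInj m n) ?_ ?_
  · simpa using this
  · intro F' hF' C hC
    obtain ⟨i, k, j, hi, hik, hk, hj, hjn, rfl⟩ := mem_negInj.1 hC
    exact costSR_negInj hi hik hk hj hjn (by simpa using hF')
  · intro C hC
    obtain ⟨i, k, j, hi, hik, hk, hj, hjn, rfl⟩ := mem_negInj.1 hC
    simpa [varsClause] using bInj_mem_vars hi hik hk hj hjn

/-- For distinct pigeons there is an injectivity clause whose blocking variable is refuted. -/
lemma exists_injectivity {m n a b j : ℕ} (ha : 1 ≤ a) (ham : a ≤ m) (hb : 1 ≤ b) (hbm : b ≤ m)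
    (hab : a ≠ b) (hj : 1 ≤ j) (hjn : j ≤ n) :
    ∃ v, v % 3 = 2 ∧ ({(pV a j, false), (pV b j, false), (v, true)} : Clause) ∈ BPHP m n ∧
      ({(v, false)} : Clause) ∈ negInj m n := by
  rcases hab.lt_or_gt with h | h
  · exact ⟨bInj a b j, bInj_mod _ _ _, mem_BPHP.2 (.inr ⟨a, b, j, ha, h, hbm, hj, hjn, rfl⟩),
      mem_negInj.2 ⟨a, b, j, ha, h, hbm, hj, hjn, rfl⟩⟩
  · exact ⟨bInj b a j, bInj_mod _ _ _, mem_BPHP.2 (.inr ⟨b, a, j, hb, h, ham, hj, hjn,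
      by rw [Finset.insert_comm]⟩), mem_negInj.2 ⟨b, a, j, hb, h, ham, hj, hjn, rfl⟩⟩

/-- The clause `p_{i,i} ∨ ¬p_{k,i}`. -/
def diagPair (i k : ℕ) : Clause := {(pV i i, true), (pV k i, false)}

/-- The unit clause `p_{i,i}`. -/
def diagUnit (i : ℕ) : Clause := {(pV i i, true)}

/-- Renaming of the pigeons in the variables `p_{i,j}` and `b_i`. -/
def renamePigeon (f : ℕ → ℕ) (v : Var) : Var :=
  if v % 3 = 0 then pV (f (v / 3).unpair.1) (v / 3).unpair.2
  else if v % 3 = 1 then bTot (f (v / 3)) else v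

lemma renamePigeon_pV (f : ℕ → ℕ) (i j : ℕ) : renamePigeon f (pV i j) = pV (f i) j := by
  have h₁ : pV i j % 3 = 0 := Nat.mul_mod_right 3 _
  have h₂ : pV i j / 3 = Nat.pair i j := Nat.mul_div_cancel_left _ (by norm_num)
  simp [renamePigeon, h₁, h₂]

lemma renamePigeon_bTot (f : ℕ → ℕ) (i : ℕ) : renamePigeon f (bTot i) = bTot (f i) := by
  have h₁ : bTot i % 3 = 1 := Nat.mul_add_mod 3 i 1
  have h₂ : bTot i / 3 = i := by
    have : (3 * i + 1) / 3 = i := by omega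
    exact this
  simp [renamePigeon, h₁, h₂]

lemma renamePigeon_of_mod {f : ℕ → ℕ} {v : Var} (h : v % 3 = 2) : renamePigeon f v = v := by
  simp [renamePigeon, h]

/-- Swap the pigeons `i` and `k`, assuming that only `k` flies to hole `i`. -/
def swapSub (i k : ℕ) : Sub := fun v =>
  if v = pV i i then .inl true
  else if v = pV k i then .inl false else .inr (renamePigeon (Equiv.swap i k) v, true)

lemma swap_mem_Icc {m i k a : ℕ} (hi : 1 ≤ i) (him : i ≤ m) (hk : 1 ≤ k) (hkm : k ≤ m)
    (ha : 1 ≤ a) (ham : a ≤ m) : 1 ≤ Equiv.swap i k a ∧ Equiv.swap i k a ≤ m := by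
  rw [Equiv.swap_apply_def]
  split_ifs <;> omega

lemma cost_swapSub {m n i k : ℕ} (hi : 1 ≤ i) (him : i ≤ m) (hk : 1 ≤ k) (hkm : k ≤ m)
    (τ : TAssign) :
    cost (BPHPblocking m n) (comp τ (swapSub i k)) ≤ cost (BPHPblocking m n) τ := by
  set e := Equiv.swap i k with he
  have hval : ∀ v ∈ BPHPblocking m n, comp τ (swapSub i k) v = τ (renamePigeon e v) ∧
      renamePigeon e v ∈ BPHPblocking m n ∧ renamePigeon e (renamePigeon e v) = v := by
    intro v hv
    rcases mem_BPHPblocking.1 hv with ⟨a, ha, ham, rfl⟩ | ⟨a, b, c, -, -, -, -, -, rfl⟩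
    · obtain ⟨h₁, h₂⟩ := swap_mem_Icc hi him hk hkm ha ham
      refine ⟨by simp [comp, swapSub, he], ?_, ?_⟩
      · rw [renamePigeon_bTot]
        exact mem_BPHPblocking.2 (.inl ⟨_, h₁, h₂, rfl⟩)
      · rw [renamePigeon_bTot, renamePigeon_bTot, he, Equiv.swap_apply_self]
    · have := renamePigeon_of_mod (f := e) (bInj_mod a b c)
      exact ⟨by simp [comp, swapSub, he], by rwa [this], by rw [this, this]⟩
  refine Finset.card_le_card_of_injOn (renamePigeon e) ?_ ?_
  · intro v hv
    obtain ⟨hvB, hv⟩ := Finset.mem_filter.1 hv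
    obtain ⟨h₁, h₂, -⟩ := hval v hvB
    exact Finset.mem_filter.2 ⟨h₂, h₁ ▸ hv⟩
  · exact Set.LeftInvOn.injOn (f₁' := renamePigeon e) fun v hv =>
      (hval v (Finset.mem_filter.1 hv).1).2.2

/-- The clauses available, besides those of `BPHP`, while `p_{i,i}` is being derived. -/
structure DiagContext (m n i : ℕ) (S : Finset Clause) : Prop where
  negInj_subset : negInj m n ⊆ S
  unit_mem : ∀ j, 1 ≤ j → j < i → diagUnit j ∈ S
  cases_of_mem : ∀ E ∈ S, E ∈ negInj m n ∨
    (∃ j k, 1 ≤ j ∧ j ≤ i ∧ j < k ∧ k ≤ m ∧ E = diagPair j k) ∨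
    (∃ j, 1 ≤ j ∧ j < i ∧ E = diagUnit j)

lemma costSR_diagPair {m n i k : ℕ} (hi : 1 ≤ i) (hik : i < k) (hk : k ≤ m)
    {S : Finset Clause} (hS : DiagContext m n i S) :
    CostSR (BPHPblocking m n) (BPHP m n + S.val) (diagPair i k) := by
  have hne : i ≠ k := hik.ne
  refine .intro (swapSub i k) (by simp [diagPair, negLit, hne, hne.symm])
    (fun E hE hnt => ?_) fun τ _ => cost_swapSub hi (hik.le.trans hk) (by omega) hk τ
  have hpii : ∀ k', clauseTrue (swapSub i k) (diagPair i k') := fun k' =>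
    ⟨(pV i i, true), by simp [diagPair], by simp [swapSub]⟩
  rw [Multiset.mem_add, mem_BPHP] at hE
  rcases hE with rfl | (⟨a, ha, ham, rfl⟩ | ⟨a, b, c, ha, hab, hb, hc, hcn, rfl⟩) | hE
  · exact absurd (hpii k) hnt
  · obtain ⟨h₁, h₂⟩ := swap_mem_Icc hi (hik.le.trans hk) (by omega) hk ha ham
    refine ⟨_, Multiset.mem_add.2 (.inl (mem_BPHP.2 (.inl ⟨_, h₁, h₂, rfl⟩))), fun l hl => ?_⟩
    rcases mem_totClause.1 hl with rfl | ⟨c, hc, hcn, rfl⟩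
    · exact ⟨by simp [diagPair, negLit], .inr (.inl ⟨(bTot a, true), mem_totClause.2 (.inl rfl),
        by simp [swapSub, renamePigeon_bTot]⟩)⟩
    · have hnt' : swapSub i k (pV a c) ≠ .inl true := fun h =>
        hnt ⟨(pV a c, true), mem_totClause.2 (.inr ⟨c, hc, hcn, rfl⟩), h⟩
      by_cases hai : a = i ∧ c = i
      · exact absurd (by simp [swapSub, hai]) hnt'
      have hneg : ¬ (Equiv.swap i k a = k ∧ c = i) := by
        rintro ⟨h, rfl⟩
        exact hai ⟨by simpa using congrArg (Equiv.swap c k) h, rfl⟩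
      refine ⟨by simpa [diagPair, negLit] using hneg, ?_⟩
      by_cases hak : a = k ∧ c = i
      · obtain ⟨rfl, rfl⟩ := hak
        exact .inl (by simp [diagPair])
      · exact .inr (.inl ⟨(pV a c, true), mem_totClause.2 (.inr ⟨c, hc, hcn, rfl⟩),
          by simp [swapSub, renamePigeon_pV, hai, hak]⟩)
  · obtain ⟨ha₁, ha₂⟩ := swap_mem_Icc hi (hik.le.trans hk) (by omega) hk ha (by omega : a ≤ m)
    obtain ⟨hb₁, hb₂⟩ := swap_mem_Icc hi (hik.le.trans hk) (by omega) hk (by omega : 1 ≤ b) hb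
    obtain ⟨v, hv, hE, hneg⟩ := exists_injectivity ha₁ ha₂ hb₁ hb₂
      ((Equiv.swap i k).injective.ne hab.ne) hc hcn
    have key : ∀ x, (pV x c, false) ∈ ({(pV a c, false), (pV b c, false),
        (bInj a b c, true)} : Clause) → negLit (pV (Equiv.swap i k x) c, false) ∉ diagPair i k ∧
        ((pV (Equiv.swap i k x) c, false) ∈ diagPair i k ∨
        ∃ l₀ ∈ ({(pV a c, false), (pV b c, false), (bInj a b c, true)} : Clause),
          appLit (swapSub i k) l₀ = .inr (pV (Equiv.swap i k x) c, false)) := by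
      intro x hx
      have hxk : ¬ (x = k ∧ c = i) := by
        rintro ⟨rfl, rfl⟩
        exact hnt ⟨_, hx, by simp [swapSub, negSV, hne.symm]⟩
      have hneg : ¬ (Equiv.swap i k x = i ∧ c = i) := by
        rintro ⟨h, rfl⟩
        exact hxk ⟨by simpa using congrArg (Equiv.swap c k) h, rfl⟩
      refine ⟨by simpa [diagPair, negLit] using hneg, ?_⟩
      by_cases hxi : x = i ∧ c = i
      · obtain ⟨rfl, rfl⟩ := hxi
        exact .inl (by simp [diagPair])
      · exact .inr ⟨_, hx, by simp [swapSub, renamePigeon_pV, hxk, hxi, negSV, negLit]⟩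
    refine ⟨_, Multiset.mem_add.2 (.inl hE), fun l hl => ?_⟩
    simp only [Finset.mem_insert, Finset.mem_singleton] at hl
    rcases hl with rfl | rfl | rfl
    · obtain ⟨h₁, h₂⟩ := key a (by simp)
      exact ⟨h₁, h₂.imp_right .inl⟩
    · obtain ⟨h₁, h₂⟩ := key b (by simp)
      exact ⟨h₁, h₂.imp_right .inl⟩
    · exact ⟨by simp [negLit, diagPair, ne_pV_of_mod hv], .inr (.inr ⟨_, Multiset.mem_add.2 (.inr
        (hS.negInj_subset hneg)), by simp [negLit], by simp [negLit]⟩)⟩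
  · rcases hS.cases_of_mem E hE with h | ⟨j, k', hj, hji, hjk, -, rfl⟩ | ⟨j, hj, hji, rfl⟩
    · obtain ⟨a, b, c, -, -, -, -, -, rfl⟩ := mem_negInj.1 h
      exact Untouched.exists_falsified
        (by simp [Untouched, swapSub, renamePigeon_of_mod (bInj_mod a b c)])
        (Multiset.mem_add.2 (.inr hE)) (by simp [negLit, diagPair])
    · rcases hji.eq_or_lt with rfl | hji
      · exact absurd (hpii k') hnt
      · refine ⟨_, Multiset.mem_add.2 (.inr (hS.unit_mem j hj hji)), fun l hl => ?_⟩
        obtain rfl := Finset.mem_singleton.1 hl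
        have hjk : j ≠ k := by omega
        refine ⟨by simp [diagPair, negLit, hjk], .inr (.inl ⟨(pV j j, true),
          by simp [diagPair], ?_⟩)⟩
        simp [swapSub, renamePigeon_pV, hji.ne, hjk, Equiv.swap_apply_of_ne_of_ne hji.ne hjk]
    · have hjk : j ≠ k := by omega
      exact Untouched.exists_falsified
        (by simp [Untouched, diagUnit, swapSub, renamePigeon_pV, hji.ne, hjk,
          Equiv.swap_apply_of_ne_of_ne hji.ne hjk])
        (Multiset.mem_add.2 (.inr hE)) (by simp [negLit, diagPair, diagUnit, hjk])

/-- Put pigeon `i`, and no other pigeon, into hole `i`. -/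
def fillSub (i : ℕ) : Sub := fun v =>
  if v = pV i i then .inl true
  else if v = bTot i ∨ (v % 3 = 0 ∧ (v / 3).unpair.2 = i) then .inl false else .inr (v, true)

lemma fillSub_pV_self (i : ℕ) : fillSub i (pV i i) = .inl true := by simp [fillSub]

lemma fillSub_pV_of_ne {i a : ℕ} (h : a ≠ i) : fillSub i (pV a i) = .inl false := by
  have h₁ : pV a i % 3 = 0 := Nat.mul_mod_right 3 _
  have h₂ : pV a i / 3 = Nat.pair a i := Nat.mul_div_cancel_left _ (by norm_num)
  simp [fillSub, h, h₁, h₂]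

lemma fillSub_pV {i a c : ℕ} (h : c ≠ i) : fillSub i (pV a c) = .inr (pV a c, true) := by
  have h₂ : pV a c / 3 = Nat.pair a c := Nat.mul_div_cancel_left _ (by norm_num)
  simp [fillSub, h, h₂]

lemma fillSub_bTot {i a : ℕ} (h : a ≠ i) : fillSub i (bTot a) = .inr (bTot a, true) := by
  have h₁ : bTot a % 3 = 1 := Nat.mul_add_mod 3 a 1
  simp [fillSub, h, h₁]

lemma fillSub_bInj (i a b c : ℕ) : fillSub i (bInj a b c) = .inr (bInj a b c, true) := by
  simp [fillSub, bInj_mod]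

lemma cost_fillSub {m n i : ℕ} (τ : TAssign) :
    cost (BPHPblocking m n) (comp τ (fillSub i)) ≤ cost (BPHPblocking m n) τ := by
  refine Finset.card_le_card fun v hv => ?_
  obtain ⟨hvB, hv⟩ := Finset.mem_filter.1 hv
  refine Finset.mem_filter.2 ⟨hvB, ?_⟩
  rcases mem_BPHPblocking.1 hvB with ⟨a, ha, ham, rfl⟩ | ⟨a, b, c, -, -, -, -, -, rfl⟩
  · by_cases h : a = i
    · simp [comp, fillSub, h] at hv
    · simpa [comp, fillSub_bTot h] using hv
  · simpa [comp, fillSub_bInj] using hv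

lemma costSR_diagUnit {m n i : ℕ} (hi : 1 ≤ i) (hin : i ≤ n) {S : Finset Clause} (hS : DiagContext m n i S)
    (hpair : ∀ k, i < k → k ≤ m → diagPair i k ∈ S) :
    CostSR (BPHPblocking m n) (BPHP m n + S.val) (diagUnit i) := by
  refine .intro (fillSub i) (by simp [diagUnit, negLit]) (fun E hE hnt => ?_)
    fun τ _ => cost_fillSub τ
  rw [Multiset.mem_add, mem_BPHP] at hE
  rcases hE with rfl | (⟨a, ha, ham, rfl⟩ | ⟨a, b, c, ha, hab, hb, hc, hcn, rfl⟩) | hE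
  · exact absurd ⟨(pV i i, true), by simp [diagUnit], fillSub_pV_self i⟩ hnt
  · rcases lt_trichotomy a i with hai | rfl | hai
    · refine ⟨_, Multiset.mem_add.2 (.inr (hS.unit_mem a ha hai)), fun l hl => ?_⟩
      obtain rfl := Finset.mem_singleton.1 hl
      exact ⟨by simp [diagUnit, negLit], .inr (.inl ⟨(pV a a, true),
        mem_totClause.2 (.inr ⟨a, ha, by omega, rfl⟩), fillSub_pV hai.ne⟩)⟩
    · exact absurd ⟨(pV a a, true), mem_totClause.2 (.inr ⟨a, ha, hin, rfl⟩), fillSub_pV_self a⟩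
        hnt
    · refine ⟨_, Multiset.mem_add.2 (.inl (mem_BPHP.2 (.inl ⟨a, ha, ham, rfl⟩))), fun l hl => ?_⟩
      rcases mem_totClause.1 hl with rfl | ⟨c, hc, hcn, rfl⟩
      · exact ⟨by simp [diagUnit, negLit], .inr (.inl ⟨_, hl, fillSub_bTot hai.ne'⟩)⟩
      · refine ⟨by simp [diagUnit, negLit], .inr ?_⟩
        by_cases hci : c = i
        · obtain rfl := hci
          exact .inr ⟨_, Multiset.mem_add.2 (.inr (hpair a hai ham)), by simp [diagPair, negLit],
            by simp [diagPair, diagUnit, negLit, Finset.pair_comm]⟩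
        · exact .inl ⟨_, hl, fillSub_pV hci⟩
  · simp only [clauseTrue, Finset.mem_insert, Finset.mem_singleton, exists_eq_or_imp,
      exists_eq_left, not_or, appLit_false, appLit_true] at hnt
    have hci : c ≠ i := by
      rintro rfl
      by_cases hac : a = c
      · exact hnt.2.1 (by simp [fillSub_pV_of_ne (show b ≠ c by omega), negSV])
      · exact hnt.1 (by simp [fillSub_pV_of_ne hac, negSV])
    exact Untouched.exists_falsified (by simp [Untouched, fillSub_pV hci, fillSub_bInj])
      (Multiset.mem_add.2 (.inl (mem_BPHP.2 (.inr ⟨a, b, c, ha, hab, hb, hc, hcn, rfl⟩))))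
      (by simp [negLit, diagUnit, hci])
  · rcases hS.cases_of_mem E hE with h | ⟨j, k', hj, hji, hjk, -, rfl⟩ | ⟨j, hj, hji, rfl⟩
    · obtain ⟨a, b, c, -, -, -, -, -, rfl⟩ := mem_negInj.1 h
      exact Untouched.exists_falsified (by simp [Untouched, fillSub_bInj])
        (Multiset.mem_add.2 (.inr hE)) (by simp [negLit, diagUnit])
    · rcases hji.eq_or_lt with rfl | hji
      · exact absurd ⟨(pV j j, true), by simp [diagPair], fillSub_pV_self j⟩ hnt
      · exact Untouched.exists_falsified (by simp [Untouched, diagPair, fillSub_pV hji.ne])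
          (Multiset.mem_add.2 (.inr hE)) (by simp [negLit, diagUnit, diagPair, hji.ne])
    · exact Untouched.exists_falsified (by simp [Untouched, diagUnit, fillSub_pV hji.ne])
        (Multiset.mem_add.2 (.inr hE)) (by simp [negLit, diagUnit])

/-- The clauses `p_{i,i} ∨ ¬p_{k,i}` with `i < k ≤ m`. -/
def diagPairs (m i : ℕ) : Finset Clause := (Finset.Icc (i + 1) m).image (diagPair i)

lemma mem_diagPairs {m i : ℕ} {E : Clause} :
    E ∈ diagPairs m i ↔ ∃ k, i < k ∧ k ≤ m ∧ E = diagPair i k := by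
  simp [diagPairs, and_assoc, eq_comm]

/-- All clauses derived once `p_{1,1}, …, p_{i,i}` are available. -/
def diagStage (m n i : ℕ) : Finset Clause :=
  negInj m n ∪ (Finset.range i).biUnion (fun j => diagPairs m (j + 1)) ∪
    (Finset.range i).image (fun j => diagUnit (j + 1))

lemma mem_diagStage {m n i : ℕ} {E : Clause} :
    E ∈ diagStage m n i ↔ E ∈ negInj m n ∨
      (∃ j k, 1 ≤ j ∧ j ≤ i ∧ j < k ∧ k ≤ m ∧ E = diagPair j k) ∨
      (∃ j, 1 ≤ j ∧ j ≤ i ∧ E = diagUnit j) := by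
  rw [diagStage, Finset.mem_union, Finset.mem_union, or_assoc, mem_range_image diagUnit,
    Finset.mem_biUnion]
  refine or_congr_right (or_congr_left ⟨?_, ?_⟩)
  · rintro ⟨j, hj, hE⟩
    obtain ⟨k, hk⟩ := mem_diagPairs.1 hE
    exact ⟨j + 1, k, by omega, by simpa [Nat.succ_le_iff] using hj, hk⟩
  · rintro ⟨j, k, hj, hji, hk⟩
    obtain ⟨j, rfl⟩ := Nat.exists_eq_add_of_le' hj
    exact ⟨j, by simpa [Nat.succ_le_iff] using hji, mem_diagPairs.2 ⟨k, hk⟩⟩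

lemma diagStage_succ (m n i : ℕ) :
    diagStage m n (i + 1) =
      insert (diagUnit (i + 1)) (diagStage m n i ∪ diagPairs m (i + 1)) := by
  ext E
  simp only [diagStage, Finset.range_add_one, Finset.biUnion_insert, Finset.image_insert,
    Finset.mem_union, Finset.mem_insert]
  tauto

lemma derivable_diagStage {m n : ℕ} (hnm : n < m) :
    ∀ i ≤ n, Derivable (BPHPblocking m n) (BPHP m n) (diagStage m n i)
  | 0, _ => by simpa [diagStage] using derivable_negInj m n
  | i + 1, hi => by
    have hctx : ∀ F ⊆ diagPairs m (i + 1), DiagContext m n (i + 1) (diagStage m n i ∪ F) := by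
      refine fun F hF => ⟨fun E hE => ?_, fun j hj hji => ?_, fun E hE => ?_⟩
      · exact Finset.mem_union_left _ (mem_diagStage.2 (.inl hE))
      · exact Finset.mem_union_left _ (mem_diagStage.2 (.inr (.inr ⟨j, hj, by omega, rfl⟩)))
      · rcases Finset.mem_union.1 hE with h | h
        · rcases mem_diagStage.1 h with h | ⟨j, k, hj, hji, hk⟩ | ⟨j, hj, hji, rfl⟩
          · exact .inl h
          · exact .inr (.inl ⟨j, k, hj, by omega, hk⟩)
          · exact .inr (.inr ⟨j, hj, by omega, rfl⟩)
        · obtain ⟨k, hk⟩ := mem_diagPairs.1 (hF h)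
          exact .inr (.inl ⟨i + 1, k, by omega, le_rfl, hk⟩)
    rw [diagStage_succ]
    refine ((derivable_diagStage hnm i (by omega)).union ?_ ?_).insert ?_ ?_
    · intro F hF C hC
      obtain ⟨k, hk, hkm, rfl⟩ := mem_diagPairs.1 hC
      exact costSR_diagPair (by omega) hk hkm (hctx F hF)
    · intro C hC
      obtain ⟨k, hk, hkm, rfl⟩ := mem_diagPairs.1 hC
      simp only [varsClause, diagPair, Finset.image_insert, Finset.image_singleton,
        Finset.insert_subset_iff, Finset.singleton_subset_iff]
      exact ⟨pV_mem_vars (by omega) (by omega) (by omega) hi,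
        pV_mem_vars (by omega) hkm (by omega) hi⟩
    · exact costSR_diagUnit (by omega) hi (hctx _ subset_rfl) fun k hk hkm =>
        Finset.mem_union_right _ (mem_diagPairs.2 ⟨k, hk, hkm, rfl⟩)
    · simpa [varsClause, diagUnit] using pV_mem_vars (by omega) (by omega) (by omega) hi

/-- Set `b_i` to false. -/
def dropSub (i : ℕ) : Sub := fun v => if v = bTot i then .inl false else .inr (v, true)

lemma costSR_neg_bTot {m n i : ℕ} (hi : 1 ≤ i) (hin : i ≤ n) {S : Finset Clause}
    (hunit : diagUnit i ∈ S) (hS : ∀ E ∈ S, (bTot i, true) ∉ E) :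
    CostSR (BPHPblocking m n) (BPHP m n + S.val) {(bTot i, false)} := by
  have keep : ∀ E ∈ BPHP m n + S.val, (bTot i, true) ∉ E → ¬ clauseTrue (dropSub i) E →
      Untouched (dropSub i) E ∧ ∀ l ∈ E, negLit l ∉ ({(bTot i, false)} : Clause) := by
    refine fun E hE hpos hnt => ⟨fun l hl => ?_, fun l hl h => ?_⟩
    · obtain ⟨v, _ | _⟩ := l
      · have : v ≠ bTot i := by
          rintro rfl
          exact hnt ⟨_, hl, by simp [dropSub, negSV]⟩
        simp [dropSub, this]
      · have : v ≠ bTot i := by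
          rintro rfl
          exact hpos hl
        simp [dropSub, this]
    · have : l = (bTot i, true) := by
        simpa [negLit] using congrArg negLit (Finset.mem_singleton.1 h)
      exact hpos (this ▸ hl)
  refine .intro (dropSub i) (by simp [negLit]) (fun E hE hnt => ?_) fun τ _ => ?_
  · rcases hE with rfl | hE
    · exact absurd ⟨(bTot i, false), by simp, by simp [dropSub, negSV]⟩ hnt
    by_cases hpos : (bTot i, true) ∈ E
    · refine ⟨_, Multiset.mem_add.2 (.inr hunit), fun l hl => ?_⟩
      obtain rfl := Finset.mem_singleton.1 hl
      refine ⟨by simp [negLit], .inr (.inl ⟨(pV i i, true), ?_, by simp [dropSub]⟩)⟩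
      rcases Multiset.mem_add.1 hE with h | h
      · rcases mem_BPHP.1 h with ⟨a, -, -, rfl⟩ | ⟨a, b, c, -, -, -, -, -, rfl⟩
        · obtain rfl : i = a := by simpa [mem_totClause] using hpos
          exact mem_totClause.2 (.inr ⟨i, hi, hin, rfl⟩)
        · simp at hpos
      · exact absurd hpos (hS E h)
    · obtain ⟨h₁, h₂⟩ := keep E hE hpos hnt
      exact h₁.exists_falsified hE h₂
  · refine Finset.card_le_card fun v hv => ?_
    obtain ⟨hvB, hv⟩ := Finset.mem_filter.1 hv
    refine Finset.mem_filter.2 ⟨hvB, ?_⟩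
    by_cases h : v = bTot i <;> simp_all [comp, dropSub]

/-- The unit clauses `¬b_i` with `i ≤ n`. -/
def negTot (n : ℕ) : Finset Clause :=
  (Finset.range n).image fun i => {((bTot (i + 1), false) : Lit)}

/-- The unit clauses `¬p_{i,j}` with `i ≤ m` and `j ≤ n`, `j < i`. -/
def negPigeon (m n : ℕ) : Finset Clause :=
  ((Finset.range m ×ˢ Finset.range n).filter fun t => t.2 < t.1).image
    fun t => {((pV (t.1 + 1) (t.2 + 1), false) : Lit)}

/-- The unit clauses `b_i` with `n < i ≤ m`. -/
def posTot (m n : ℕ) : Finset Clause :=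
  (Finset.Icc (n + 1) m).image fun i => {((bTot i, true) : Lit)}

lemma mem_negTot {n : ℕ} {E : Clause} :
    E ∈ negTot n ↔ ∃ i, 1 ≤ i ∧ i ≤ n ∧ E = {(bTot i, false)} :=
  mem_range_image fun i => ({(bTot i, false)} : Clause)

lemma mem_negPigeon {m n : ℕ} {E : Clause} :
    E ∈ negPigeon m n ↔ ∃ i j, i ≤ m ∧ 1 ≤ j ∧ j ≤ n ∧ j < i ∧ E = {(pV i j, false)} := by
  simp only [negPigeon, Finset.mem_image, Finset.mem_filter, Finset.mem_product, Finset.mem_range]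
  constructor
  · rintro ⟨⟨i, j⟩, h, rfl⟩
    simp only at h
    exact ⟨i + 1, j + 1, by omega, by omega, by omega, by omega, rfl⟩
  · rintro ⟨i, j, hi, hj, hjn, hji, rfl⟩
    refine ⟨(i - 1, j - 1), by simp only; omega, ?_⟩
    simp only
    rw [Nat.sub_add_cancel hj, Nat.sub_add_cancel (by omega)]

lemma mem_posTot {m n : ℕ} {E : Clause} :
    E ∈ posTot m n ↔ ∃ i, n < i ∧ i ≤ m ∧ E = {(bTot i, true)} := by
  simp [posTot, and_assoc, eq_comm]

/-- All the clauses of the derivation. -/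
def allClauses (m n : ℕ) : Finset Clause :=
  diagStage m n n ∪ negTot n ∪ negPigeon m n ∪ posTot m n

lemma derivable_allClauses {m n : ℕ} (hnm : n < m) :
    Derivable (BPHPblocking m n) (BPHP m n) (allClauses m n) := by
  refine (((derivable_diagStage hnm n le_rfl).union ?_ ?_).union ?_ ?_).union ?_ ?_
  · intro F hF C hC
    obtain ⟨i, hi, hin, rfl⟩ := mem_negTot.1 hC
    refine costSR_neg_bTot hi hin (Finset.mem_union_left _
      (mem_diagStage.2 (.inr (.inr ⟨i, hi, hin, rfl⟩)))) fun E hE => ?_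
    rcases Finset.mem_union.1 hE with h | h
    · rcases mem_diagStage.1 h with h | ⟨j, k, -, -, -, -, rfl⟩ | ⟨j, -, -, rfl⟩
      · obtain ⟨a, b, c, -, -, -, -, -, rfl⟩ := mem_negInj.1 h
        simp
      · simp [diagPair]
      · simp [diagUnit]
    · obtain ⟨a, -, -, rfl⟩ := mem_negTot.1 (hF h)
      simp
  · intro C hC
    obtain ⟨i, hi, hin, rfl⟩ := mem_negTot.1 hC
    simpa [varsClause] using bTot_mem_vars hi (by omega)
  · intro F _ C hC
    obtain ⟨i, j, him, hj, hjn, hji, rfl⟩ := mem_negPigeon.1 hC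
    obtain ⟨v, hv, hE, hneg⟩ := exists_injectivity (m := m) (n := n) (a := j) (b := i) (j := j)
      hj (by omega) (by omega) him hji.ne hj hjn
    refine .of_falsified (by simp [negLit]) (Multiset.mem_add.2 (.inl hE)) fun l hl => ?_
    have hmem : ∀ E ∈ diagStage m n n, E ∈ diagStage m n n ∪ negTot n ∪ F := fun E h =>
      Finset.mem_union_left _ (Finset.mem_union_left _ h)
    simp only [Finset.mem_insert, Finset.mem_singleton] at hl
    rcases hl with rfl | rfl | rfl
    · exact ⟨by simp [negLit], .inr (Multiset.mem_add.2 (.inr (hmem _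
        (mem_diagStage.2 (.inr (.inr ⟨j, hj, hjn, by simp [diagUnit, negLit]⟩))))))⟩
    · exact ⟨by simp [negLit], .inl (by simp)⟩
    · exact ⟨by simp [negLit, ne_pV_of_mod hv], .inr (Multiset.mem_add.2 (.inr (hmem _
        (mem_diagStage.2 (.inl (by simpa [negLit] using hneg))))))⟩
  · intro C hC
    obtain ⟨i, j, him, hj, hjn, hji, rfl⟩ := mem_negPigeon.1 hC
    simpa [varsClause] using pV_mem_vars (by omega) him hj hjn
  · intro F _ C hC
    obtain ⟨i, hi, him, rfl⟩ := mem_posTot.1 hC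
    refine .of_falsified (by simp [negLit]) (Multiset.mem_add.2 (.inl (mem_BPHP.2
      (.inl ⟨i, by omega, him, rfl⟩)))) fun l hl => ?_
    rcases mem_totClause.1 hl with rfl | ⟨j, hj, hjn, rfl⟩
    · exact ⟨by simp [negLit], .inl (by simp)⟩
    · exact ⟨by simp [negLit], .inr (Multiset.mem_add.2 (.inr (Finset.mem_union_left _
        (Finset.mem_union_right _ (mem_negPigeon.2
          ⟨i, j, him, hj, hjn, by omega, by simp [negLit]⟩)))))⟩
  · intro C hC
    obtain ⟨i, hi, him, rfl⟩ := mem_posTot.1 hC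
    simpa [varsClause] using bTot_mem_vars (by omega) him

lemma card_allClauses_le {m n : ℕ} (hn : 1 ≤ n) (hnm : n < m) :
    (allClauses m n).card ≤ (m + n) ^ 4 := by
  have h₁ : (negInj m n).card ≤ m * (m * n) :=
    Finset.card_image_le.trans ((Finset.card_filter_le _ _).trans (by simp))
  have h₂ : ((Finset.range n).biUnion fun j => diagPairs m (j + 1)).card ≤ n * m := by
    refine (Finset.card_biUnion_le_card_mul _ _ m fun j _ => ?_).trans (by simp)
    exact Finset.card_image_le.trans (by simp)
  have h₃ : ((Finset.range n).image fun j => diagUnit (j + 1)).card ≤ n :=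
    Finset.card_image_le.trans (by simp)
  have h₄ : (negTot n).card ≤ n := Finset.card_image_le.trans (by simp)
  have h₅ : (negPigeon m n).card ≤ m * n :=
    Finset.card_image_le.trans ((Finset.card_filter_le _ _).trans (by simp))
  have h₆ : (posTot m n).card ≤ m := Finset.card_image_le.trans (by simp)
  have hcard : (allClauses m n).card ≤ m * (m * n) + n * m + n + n + m * n + m := by
    refine (Finset.card_union_le _ _).trans (add_le_add ?_ h₆)
    refine (Finset.card_union_le _ _).trans (add_le_add ?_ h₅)
    refine (Finset.card_union_le _ _).trans (add_le_add ?_ h₄)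
    refine (Finset.card_union_le _ _).trans (add_le_add ?_ h₃)
    exact (Finset.card_union_le _ _).trans (add_le_add h₁ h₂)
  obtain ⟨N, hN⟩ : ∃ N, N = m + n := ⟨_, rfl⟩
  have hN3 : 3 ≤ N := by omega
  have hmn : m * n ≤ N * N := Nat.mul_le_mul (by omega) (by omega)
  have hmmn : m * (m * n) ≤ N * (N * N) := Nat.mul_le_mul (by omega) hmn
  have hNN : 3 * N ≤ N * N := Nat.mul_le_mul_right N hN3
  have hNNN : 3 * (N * N) ≤ N * (N * N) := Nat.mul_le_mul_right _ hN3
  have hN4 : 3 * (N * (N * N)) ≤ N ^ 4 :=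
    (Nat.mul_le_mul_right _ hN3).trans (le_of_eq (by ring))
  rw [← hN]
  rw [mul_comm n m] at hcard
  omega

/-- cost-SR proves `cost(BPHP(m,n)) = m − n` in polynomial size:
there is a constant `c` such that for all `m > n ≥ 1` there is a cost-SR
derivation from `BPHP(m,n)`, of length at most `(m+n)^c`, containing unit
clauses for `m−n` distinct blocking variables and the unit clauses `¬b` for
every other blocking variable `b`. -/
theorem BPHP_costSR_short_proof :
    ∃ c : ℕ, ∀ m n : ℕ, 1 ≤ n → n < m →
      ∃ (L : List Clause) (I : Finset Var),
        IsDeriv CostSR (BPHPblocking m n) (BPHP m n) L ∧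
        L.length ≤ (m + n) ^ c ∧
        I ⊆ BPHPblocking m n ∧ I.card = m - n ∧
        (∀ b ∈ I, ({(b, true)} : Clause) ∈ L) ∧
        (∀ b ∈ BPHPblocking m n, b ∉ I → ({(b, false)} : Clause) ∈ L) := by
  refine ⟨4, fun m n hn hnm => ?_⟩
  obtain ⟨L, hL, hnodup, hLS⟩ := derivable_allClauses hnm
  have hmem : ∀ E ∈ allClauses m n, E ∈ L := fun E hE => by rwa [← hLS, List.mem_toFinset] at hE
  refine ⟨L, (Finset.Icc (n + 1) m).image bTot, hL, ?_, ?_, ?_, ?_, ?_⟩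
  · rw [← List.toFinset_card_of_nodup hnodup, hLS]
    exact card_allClauses_le hn hnm
  · intro b hb
    obtain ⟨i, hi, rfl⟩ := Finset.mem_image.1 hb
    rw [Finset.mem_Icc] at hi
    exact mem_BPHPblocking.2 (.inl ⟨i, by omega, hi.2, rfl⟩)
  · rw [Finset.card_image_of_injective _ fun i j h => bTot_inj.1 h, Nat.card_Icc]
    omega
  · intro b hb
    obtain ⟨i, hi, rfl⟩ := Finset.mem_image.1 hb
    rw [Finset.mem_Icc] at hi
    exact hmem _ (Finset.mem_union_right _ (mem_posTot.2 ⟨i, by omega, hi.2, rfl⟩))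
  · intro b hb hbI
    refine hmem _ (Finset.mem_union_left _ (Finset.mem_union_left _ ?_))
    rcases mem_BPHPblocking.1 hb with ⟨i, hi, him, rfl⟩ | ⟨i, k, j, hi, hik, hk, hj, hjn, rfl⟩
    · refine Finset.mem_union_right _ (mem_negTot.2 ⟨i, hi, ?_, rfl⟩)
      by_contra h
      exact hbI (Finset.mem_image_of_mem _ (Finset.mem_Icc.2 ⟨by omega, him⟩))
    · exact Finset.mem_union_left _ (mem_diagStage.2 (.inl (mem_negInj.2
        ⟨i, k, j, hi, hik, hk, hj, hjn, rfl⟩)))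

end PaperMaxSAT
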